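/- Let 7/3 < p < 5 and 1 < q < p. The function f(a, b, c) = max_{z > 0} { a z² + b z^{(3/2)(q−1)} − c z^{(3/2)(p−1)} } is well defined and continuous on (0, ∞) × (0, ∞) × (0, ∞). -/

import Mathlib

open Set

noncomputable section

/-- The fiber function `z ↦ a z² + b z^{(3/2)(q−1)} − c z^{(3/2)(p−1)}`. -/
def fiberFun (p q a b c : ℝ) : ℝ → ℝ :=
  fun z => a * z ^ 2 + b * z ^ ((3/2) * (q - 1)) - c * z ^ ((3/2) * (p - 1))

open Filter Topology

/-- A power function dominates, with one threshold, all combinations of lower powers whose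
coefficients are bounded by `A` and `B`. -/
theorem exists_forall_le_add_rpow_le {r s : ℝ} (hs : 2 < s) (hrs : r < s) (A B : ℝ) {C : ℝ}
    (hA : 0 ≤ A) (hB : 0 ≤ B) (hC : 0 < C) :
    ∃ R : ℝ, ∀ z, R ≤ z → A * z ^ 2 + B * z ^ r ≤ C * z ^ s := by
  have hm : 0 < s - max 2 r := sub_pos.2 (max_lt hs hrs)
  obtain ⟨R, hR⟩ := eventually_atTop.1
    (((tendsto_rpow_atTop hm).eventually_ge_atTop ((A + B) / C)).and (eventually_ge_atTop 1))
  refine ⟨R, fun z hz => ?_⟩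
  obtain ⟨h, hz1⟩ := hR z hz
  rw [div_le_iff₀ hC] at h
  have h2 : z ^ 2 ≤ z ^ max 2 r := by
    rw [← Real.rpow_two]
    exact Real.rpow_le_rpow_of_exponent_le hz1 (le_max_left _ _)
  have hr : z ^ r ≤ z ^ max 2 r := Real.rpow_le_rpow_of_exponent_le hz1 (le_max_right _ _)
  have hz0 : 0 < z := by linarith
  calc A * z ^ 2 + B * z ^ r ≤ A * z ^ max 2 r + B * z ^ max 2 r := by gcongr
    _ = (A + B) * z ^ max 2 r := by ring
    _ ≤ z ^ (s - max 2 r) * C * z ^ max 2 r := by gcongr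
    _ = C * (z ^ (s - max 2 r) * z ^ max 2 r) := by ring
    _ = C * z ^ s := by rw [← Real.rpow_add hz0, sub_add_cancel]

theorem continuous_uncurry_fiberFun {p q : ℝ} (hp : 1 < p) (hq : 1 < q) :
    Continuous (fun y : (ℝ × ℝ × ℝ) × ℝ => fiberFun p q y.1.1 y.1.2.1 y.1.2.2 y.2) := by
  have hr : 0 ≤ (3/2) * (q - 1) := by linarith
  have hs : 0 ≤ (3/2) * (p - 1) := by linarith
  unfold fiberFun
  exact (by fun_prop : Continuous fun y : (ℝ × ℝ × ℝ) × ℝ => y.1.1 * y.2 ^ 2).add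
    ((by fun_prop : Continuous fun y : (ℝ × ℝ × ℝ) × ℝ => y.1.2.1).mul
      (continuous_snd.rpow_const fun _ => Or.inr hr)) |>.sub
    ((by fun_prop : Continuous fun y : (ℝ × ℝ × ℝ) × ℝ => y.1.2.2).mul
      (continuous_snd.rpow_const fun _ => Or.inr hs))

theorem fiberFun_zero {p q : ℝ} (hp : 1 < p) (hq : 1 < q) (a b c : ℝ) :
    fiberFun p q a b c 0 = 0 := by
  have hr : (3/2) * (q - 1) ≠ 0 := by linarith
  have hs : (3/2) * (p - 1) ≠ 0 := by linarith
  simp only [fiberFun, Real.zero_rpow hr, Real.zero_rpow hs]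
  norm_num

theorem exists_fiberFun_pos {p : ℝ} (q : ℝ) (hp : 7/3 < p) {a b c : ℝ}
    (ha : 0 < a) (hb : 0 < b) : ∃ z, 0 < z ∧ 0 < fiberFun p q a b c z := by
  have hs : 0 < (3/2) * (p - 1) - 2 := by linarith
  have ht : Tendsto (fun z : ℝ => c * z ^ ((3/2) * (p - 1) - 2)) (𝓝[>] 0) (𝓝 0) := by
    have h := ((Real.continuous_rpow_const hs.le).const_mul c).tendsto 0
    rw [Real.zero_rpow hs.ne', mul_zero] at h
    exact h.mono_left nhdsWithin_le_nhds
  obtain ⟨z, hz, hz0⟩ := ((ht.eventually_lt_const ha).and self_mem_nhdsWithin).exists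
  have hz0 : 0 < z := hz0
  refine ⟨z, hz0, ?_⟩
  have key : z ^ ((3/2) * (p - 1)) = z ^ ((3/2) * (p - 1) - 2) * z ^ 2 := by
    rw [← Real.rpow_two, ← Real.rpow_add hz0, sub_add_cancel]
  have h1 : 0 < b * z ^ ((3/2) * (q - 1)) := mul_pos hb (Real.rpow_pos_of_pos hz0 _)
  have h2 : 0 < (a - c * z ^ ((3/2) * (p - 1) - 2)) * z ^ 2 :=
    mul_pos (sub_pos.2 hz) (by positivity)
  simp only [fiberFun]
  rw [key]
  linarith

/-- If the fiber function is nonpositive beyond `R`, its maximum over `[0, ∞)` is attained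
in `(0, R]`. -/
theorem exists_isMaxOn_fiberFun {p q : ℝ} (hp : 7/3 < p) (hq : 1 < q) {a b c R : ℝ}
    (ha : 0 < a) (hb : 0 < b) (hR : ∀ z, R ≤ z → fiberFun p q a b c z ≤ 0) :
    ∃ z ∈ Ioc 0 R, IsMaxOn (fiberFun p q a b c) (Ici 0) z := by
  obtain ⟨y, hy0, hy⟩ := exists_fiberFun_pos q hp (c := c) ha hb
  have hyR : y ≤ R := le_of_not_ge fun h => (hR y h).not_gt hy
  have hcont : Continuous (fiberFun p q a b c) :=
    (continuous_uncurry_fiberFun (by linarith) hq).comp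
      (Continuous.prodMk_right (a, b, c))
  obtain ⟨z, hz, hmax⟩ := isCompact_Icc.exists_isMaxOn (s := Icc 0 R)
    ⟨y, hy0.le, hyR⟩ hcont.continuousOn
  have hpos : 0 < fiberFun p q a b c z := hy.trans_le (hmax ⟨hy0.le, hyR⟩)
  have hz0 : z ≠ 0 := by
    rintro rfl
    exact hpos.ne' (fiberFun_zero (by linarith) hq a b c)
  refine ⟨z, ⟨lt_of_le_of_ne hz.1 hz0.symm, hz.2⟩, fun w hw => ?_⟩
  rcases le_total w R with h | h
  · exact hmax ⟨hw, h⟩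
  · exact (hR w h).trans hpos.le

/-- `f(a,b,c) = max_{z>0} { a z² + b z^{(3/2)(q−1)} − c z^{(3/2)(p−1)} }`
is well defined (the maximum is attained) and continuous on `(0,∞)³`. -/
theorem statement14 (p q : ℝ) (hp1 : 7/3 < p) (hp2 : p < 5) (hq1 : 1 < q) (hqp : q < p) :
    (∀ a b c : ℝ, 0 < a → 0 < b → 0 < c →
      ∃ z : ℝ, 0 < z ∧ IsMaxOn (fiberFun p q a b c) (Ioi 0) z) ∧
    ContinuousOn
      (fun x : ℝ × ℝ × ℝ => sSup (fiberFun p q x.1 x.2.1 x.2.2 '' Ioi 0))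
      {x : ℝ × ℝ × ℝ | 0 < x.1 ∧ 0 < x.2.1 ∧ 0 < x.2.2} := by
  have hs : 2 < (3/2) * (p - 1) := by linarith
  have hrs : (3/2) * (q - 1) < (3/2) * (p - 1) := by linarith
  constructor
  · intro a b c ha hb hc
    obtain ⟨R, hR⟩ := exists_forall_le_add_rpow_le hs hrs a b ha.le hb.le hc
    obtain ⟨z, hz, hmax⟩ := exists_isMaxOn_fiberFun hp1 hq1 ha hb
      fun z hz => sub_nonpos.2 (hR z hz)
    exact ⟨z, hz.1, hmax.on_subset Ioi_subset_Ici_self⟩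
  · rintro ⟨a, b, c⟩ ⟨ha, hb, hc⟩
    dsimp only at ha hb hc
    obtain ⟨R, hR⟩ := exists_forall_le_add_rpow_le hs hrs (a + 1) (b + 1)
      (by linarith) (by linarith) (half_pos hc)
    have hcont : Continuous fun x : ℝ × ℝ × ℝ =>
        sSup (fiberFun p q x.1 x.2.1 x.2.2 '' Icc 0 (max R 0)) :=
      isCompact_Icc.continuous_sSup (continuous_uncurry_fiberFun (by linarith) hq1)
    refine ContinuousAt.continuousWithinAt (hcont.continuousAt.congr ?_)
    have hU : {x : ℝ × ℝ × ℝ | (0 < x.1 ∧ x.1 < a + 1) ∧ (0 < x.2.1 ∧ x.2.1 < b + 1) ∧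
        c / 2 < x.2.2} ∈ 𝓝 (a, b, c) := by
      apply IsOpen.mem_nhds
      · exact ((isOpen_lt (by fun_prop) (by fun_prop)).and
          (isOpen_lt (by fun_prop) (by fun_prop))).and
          (((isOpen_lt (by fun_prop) (by fun_prop)).and
          (isOpen_lt (by fun_prop) (by fun_prop))).and
          (isOpen_lt (by fun_prop) (by fun_prop)))
      · exact ⟨⟨ha, lt_add_one a⟩, ⟨hb, lt_add_one b⟩, half_lt_self hc⟩
    filter_upwards [hU] with ⟨a', b', c'⟩ ⟨⟨ha0, ha1⟩, ⟨hb0, hb1⟩, hc1⟩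
    dsimp only at ha0 ha1 hb0 hb1 hc1 ⊢
    have hneg : ∀ z, max R 0 ≤ z → fiberFun p q a' b' c' z ≤ 0 := by
      intro z hz
      have hz0 : 0 ≤ z := (le_max_right _ _).trans hz
      refine sub_nonpos.2 ?_
      calc a' * z ^ 2 + b' * z ^ ((3/2) * (q - 1))
          ≤ (a + 1) * z ^ 2 + (b + 1) * z ^ ((3/2) * (q - 1)) := by gcongr
        _ ≤ c / 2 * z ^ ((3/2) * (p - 1)) := hR z ((le_max_left _ _).trans hz)
        _ ≤ c' * z ^ ((3/2) * (p - 1)) := by gcongr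
    obtain ⟨z, hz, hmax⟩ := exists_isMaxOn_fiberFun hp1 hq1 ha0 hb0 hneg
    have hsup : ∀ s : Set ℝ, z ∈ s → s ⊆ Ici 0 →
        sSup (fiberFun p q a' b' c' '' s) = fiberFun p q a' b' c' z := fun s hzs hs0 =>
      IsGreatest.csSup_eq ⟨mem_image_of_mem _ hzs, forall_mem_image.2 fun w hw => hmax (hs0 hw)⟩
    rw [hsup (Icc 0 (max R 0)) ⟨hz.1.le, hz.2⟩ Icc_subset_Ici_self,
      hsup (Ioi 0) hz.1 Ioi_subset_Ici_self]
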